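/- arXiv:2410.22853 — 2 statements merged into one kernel-verified Lean document; each statement's English description precedes it below -/
import Mathlib

section
/- (Large-order asymptotics of (h_n^{(1)})'.) For every x ∈ ℂ with x ≠ 0 there exists a constant C > 0 such that for every integer n ≥ 1, |i·x^{n+2}·(h_n^{(1)})'(x) + (n+1)·(2n−1)!!| ≤ C·(2n−1)!!, where (h_n^{(1)})' denotes the complex derivative of h_n^{(1)}. -/
open Complex

/-- The spherical Bessel function of the first kind `j_n`, defined by its power series
`j_n(x) = ∑_{m} (-1)^m x^(n+2m) / (2^m m! (2n+2m+1)!!)`. -/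
noncomputable def sphBesselJ (n : ℕ) (x : ℂ) : ℂ :=
  ∑' m : ℕ, ((-1 : ℂ) ^ m * x ^ (n + 2 * m)) /
    ((2 : ℂ) ^ m * (Nat.factorial m : ℂ) * (Nat.doubleFactorial (2 * (n + m) + 1) : ℂ))

/-- The spherical Neumann function `y_n`, defined by the series
`y_n(x) = -((2n)!/(2^n n!)) ∑_m (-1)^m x^(2m-n-1) / (2^m m! (-2n+1)(-2n+3)⋯(-2n+2m-1))`. -/
noncomputable def sphBesselY (n : ℕ) (x : ℂ) : ℂ :=
  -((Nat.factorial (2 * n) : ℂ) / ((2 : ℂ) ^ n * (Nat.factorial n : ℂ))) *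
    ∑' m : ℕ, ((-1 : ℂ) ^ m * x ^ (2 * (m : ℤ) - (n : ℤ) - 1)) /
      ((2 : ℂ) ^ m * (Nat.factorial m : ℂ) *
        ∏ j ∈ Finset.range m, ((2 * (j : ℂ) + 1) - 2 * (n : ℂ)))

/-- The spherical Hankel function of the first kind `h_n^{(1)} = j_n + i y_n`. -/
noncomputable def sphHankelH1 (n : ℕ) (x : ℂ) : ℂ :=
  sphBesselJ n x + Complex.I * sphBesselY n x

theorem summable_two_mul_add_two_mul_pow_div_factorial (r : ℝ) (hr : 0 ≤ r) :
    Summable fun m : ℕ => (2 * (m : ℝ) + 2) * (r ^ m / (m.factorial : ℝ)) := by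
  refine Summable.of_nonneg_of_le (fun m => by positivity) (fun m => ?_)
    ((Real.summable_pow_div_factorial (2 * r)).mul_left 2)
  have h : (m : ℝ) + 1 ≤ 2 ^ m := by exact_mod_cast Nat.lt_two_pow_self (n := m)
  have h2 : 0 ≤ r ^ m / (m.factorial : ℝ) := by positivity
  calc (2 * (m : ℝ) + 2) * (r ^ m / (m.factorial : ℝ))
      ≤ (2 * 2 ^ m) * (r ^ m / (m.factorial : ℝ)) := by gcongr; linarith
    _ = 2 * ((2 * r) ^ m / (m.factorial : ℝ)) := by rw [mul_pow]; ring

/-- Termwise differentiation of an even power series whose coefficients are at most `1 / m!`. -/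
theorem hasDerivAt_tsum_even_pow (a : ℕ → ℂ) (ha : ∀ m, ‖a m‖ ≤ 1 / (m.factorial : ℝ)) (x : ℂ) :
    HasDerivAt (fun z => ∑' m : ℕ, a m * z ^ (2 * m))
      (∑' m : ℕ, a m * (((2 * m : ℕ) : ℂ) * x ^ (2 * m - 1))) x := by
  set R : ℝ := ‖x‖ + 1 with hR
  have hR1 : 1 ≤ R := by have := norm_nonneg x; linarith
  refine hasDerivAt_tsum_of_isPreconnected (t := Metric.ball (0 : ℂ) R) (y₀ := 0)
    (summable_two_mul_add_two_mul_pow_div_factorial (R ^ 2) (by positivity))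
    Metric.isOpen_ball (convex_ball (0 : ℂ) R).isPreconnected
    (g := fun m z => a m * z ^ (2 * m))
    (g' := fun m z => a m * (((2 * m : ℕ) : ℂ) * z ^ (2 * m - 1))) ?_ ?_ ?_ ?_ ?_
  · intro m z _
    exact (hasDerivAt_pow (2 * m) z).const_mul (a m)
  · intro m z hz
    have hz' : ‖z‖ ≤ R := by simpa using (Metric.mem_ball.1 hz).le
    rw [norm_mul, norm_mul, norm_pow, Complex.norm_natCast]
    calc ‖a m‖ * (((2 * m : ℕ) : ℝ) * ‖z‖ ^ (2 * m - 1))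
        ≤ (1 / (m.factorial : ℝ)) * ((2 * (m : ℝ) + 2) * (R ^ 2) ^ m) := by
          gcongr
          · exact ha m
          · push_cast; linarith
          · rw [← pow_mul]
            exact (pow_le_pow_left₀ (norm_nonneg z) hz' _).trans
              (pow_le_pow_right₀ hR1 (by omega))
      _ = _ := by ring
  · simp; positivity
  · refine summable_of_ne_finset_zero (s := {0}) fun m hm => ?_
    have : m ≠ 0 := by simpa using hm
    simp [this]
  · simp [hR]

theorem summable_shifted_even_pow (a : ℕ → ℂ) (ha : ∀ m, ‖a m‖ ≤ 1 / (m.factorial : ℝ)) (c x : ℂ) :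
    Summable fun m : ℕ => (c + 2 * m) * (a m * x ^ (2 * m)) := by
  refine Summable.of_norm_bounded (g := fun m : ℕ =>
    (‖c‖ + 1) * ((2 * (m : ℝ) + 2) * ((‖x‖ ^ 2) ^ m / (m.factorial : ℝ))))
    ((summable_two_mul_add_two_mul_pow_div_factorial _ (by positivity)).mul_left _) fun m => ?_
  have h : ‖c + 2 * m‖ ≤ (‖c‖ + 1) * (2 * (m : ℝ) + 2) := by
    refine (norm_add_le _ _).trans ?_
    have : ‖(2 : ℂ) * m‖ = 2 * m := by simp
    rw [this]
    nlinarith [norm_nonneg c, mul_nonneg (norm_nonneg c) (Nat.cast_nonneg (α := ℝ) m)]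
  rw [norm_mul, norm_mul, norm_pow]
  calc ‖c + 2 * m‖ * (‖a m‖ * ‖x‖ ^ (2 * m))
      ≤ ((‖c‖ + 1) * (2 * (m : ℝ) + 2)) * ((1 / (m.factorial : ℝ)) * ‖x‖ ^ (2 * m)) := by
        gcongr
        exact ha m
    _ = _ := by rw [← pow_mul]; ring

theorem hasDerivAt_zpow_mul_tsum_even_pow (a : ℕ → ℂ) (ha : ∀ m, ‖a m‖ ≤ 1 / (m.factorial : ℝ))
    (k : ℤ) (x : ℂ) (hx : x ≠ 0) :
    HasDerivAt (fun z => z ^ k * ∑' m : ℕ, a m * z ^ (2 * m))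
      (x ^ (k - 1) * ∑' m : ℕ, ((k : ℂ) + 2 * m) * (a m * x ^ (2 * m))) x := by
  have h := (hasDerivAt_zpow k x (Or.inl hx)).mul (hasDerivAt_tsum_even_pow a ha x)
  refine h.congr_deriv ?_
  have hs := summable_shifted_even_pow a ha
  have hs1 : Summable fun m : ℕ => a m * x ^ (2 * m) := by
    have := (hs 1 x).sub (hs 0 x)
    refine this.congr fun m => ?_
    ring
  have hx1 : x ^ k = x ^ (k - 1) * x := by rw [zpow_sub_one₀ hx]; field_simp
  have e1 : ∑' m : ℕ, ((k : ℂ) + 2 * m) * (a m * x ^ (2 * m))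
      = k * (∑' m : ℕ, a m * x ^ (2 * m)) + ∑' m : ℕ, ((0 : ℂ) + 2 * m) * (a m * x ^ (2 * m)) := by
    rw [← tsum_mul_left, ← (hs1.mul_left _).tsum_add (hs 0 x)]
    exact tsum_congr fun m => by ring
  have e2 : x * ∑' m : ℕ, a m * (((2 * m : ℕ) : ℂ) * x ^ (2 * m - 1))
      = ∑' m : ℕ, ((0 : ℂ) + 2 * m) * (a m * x ^ (2 * m)) := by
    rw [← tsum_mul_left]
    refine tsum_congr fun m => ?_
    rcases m with _ | m
    · simp
    · rw [show 2 * (m + 1) - 1 = 2 * m + 1 by omega, show 2 * (m + 1) = 2 * m + 1 + 1 by omega]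
      push_cast
      ring
  rw [e1, ← e2, hx1]
  ring

/-- The coefficients of `x ^ (-n) * j_n x` as a series in `x ^ 2`. -/
noncomputable def sphBesselJCoeff (n m : ℕ) : ℂ :=
  (-1) ^ m / ((2 : ℂ) ^ m * (Nat.factorial m : ℂ) * (Nat.doubleFactorial (2 * (n + m) + 1) : ℂ))

/-- The coefficients of `x ^ (n + 1) * y_n x`, up to normalization, as a series in `x ^ 2`. -/
noncomputable def sphBesselYCoeff (n m : ℕ) : ℂ :=
  (-1) ^ m / ((2 : ℂ) ^ m * (Nat.factorial m : ℂ) *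
    ∏ j ∈ Finset.range m, ((2 * (j : ℂ) + 1) - 2 * (n : ℂ)))

theorem factorial_mul_le_doubleFactorial (n m : ℕ) :
    n.factorial * (n + 2 * m) ≤ Nat.doubleFactorial (2 * (n + m) + 1) := by
  have h : ∀ k : ℕ, k.factorial * (2 * k + 1) ≤ Nat.doubleFactorial (2 * k + 1) := by
    intro k
    induction k with
    | zero => simp
    | succ k ih =>
      rw [show 2 * (k + 1) + 1 = 2 * k + 1 + 2 by ring, Nat.doubleFactorial_add_two,
        Nat.factorial_succ]
      have : (k + 1) * k.factorial ≤ k.factorial * (2 * k + 1) := by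
        rw [mul_comm]; gcongr; omega
      rw [mul_comm (2 * k + 1 + 2)]
      gcongr
      exact this.trans ih
  refine le_trans ?_ (h (n + m))
  exact Nat.mul_le_mul (Nat.factorial_le (by omega)) (by omega)

theorem norm_sphBesselJCoeff (n m : ℕ) : ‖sphBesselJCoeff n m‖ =
    1 / ((2 : ℝ) ^ m * (m.factorial : ℝ) * (Nat.doubleFactorial (2 * (n + m) + 1) : ℝ)) := by
  simp [sphBesselJCoeff]

theorem norm_sphBesselJCoeff_le (n m : ℕ) : ‖sphBesselJCoeff n m‖ ≤ 1 / (m.factorial : ℝ) := by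
  rw [norm_sphBesselJCoeff]
  have h1 : (1 : ℝ) ≤ 2 ^ m := one_le_pow₀ (by norm_num)
  have h2 : (1 : ℝ) ≤ (Nat.doubleFactorial (2 * (n + m) + 1) : ℝ) := by
    exact_mod_cast Nat.doubleFactorial_pos _
  have h3 : (0 : ℝ) < m.factorial := by positivity
  gcongr
  calc (m.factorial : ℝ) = 1 * m.factorial * 1 := by ring
    _ ≤ _ := by gcongr

theorem add_mul_norm_sphBesselJCoeff_le (n m : ℕ) :
    ‖(n : ℂ) + 2 * m‖ * ‖sphBesselJCoeff n m‖ ≤ 1 / (n.factorial : ℝ) * (1 / (m.factorial : ℝ)) := by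
  rw [norm_sphBesselJCoeff, show (n : ℂ) + 2 * m = ((n + 2 * m : ℕ) : ℂ) by push_cast; ring,
    Complex.norm_natCast, mul_one_div, div_mul_div_comm]
  have h0 : (n.factorial : ℝ) * ((n + 2 * m : ℕ) : ℝ)
      ≤ (Nat.doubleFactorial (2 * (n + m) + 1) : ℝ) := by
    exact_mod_cast factorial_mul_le_doubleFactorial n m
  have h1 : (1 : ℝ) ≤ 2 ^ m := one_le_pow₀ (by norm_num)
  have h2 : (0 : ℝ) < (Nat.doubleFactorial (2 * (n + m) + 1) : ℝ) := by
    exact_mod_cast Nat.doubleFactorial_pos _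
  rw [div_le_div_iff₀ (by positivity) (by positivity)]
  calc ((n + 2 * m : ℕ) : ℝ) * ((n.factorial : ℝ) * m.factorial)
      = 1 * m.factorial * (n.factorial * ((n + 2 * m : ℕ) : ℝ)) := by ring
    _ ≤ 2 ^ m * m.factorial * (Nat.doubleFactorial (2 * (n + m) + 1) : ℝ) := by gcongr
    _ = _ := by ring

theorem one_le_norm_odd_sub_even (j n : ℕ) : 1 ≤ ‖(2 * (j : ℂ) + 1) - 2 * (n : ℂ)‖ := by
  rw [show (2 * (j : ℂ) + 1) - 2 * (n : ℂ) = ((2 * (j : ℤ) + 1 - 2 * n : ℤ) : ℂ) by push_cast; ring,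
    Complex.norm_intCast]
  have h : (2 * (j : ℤ) + 1 - 2 * n) ≠ 0 := by omega
  exact_mod_cast Int.one_le_abs h

theorem one_le_norm_prod_odd_sub_even (n m k : ℕ) :
    1 ≤ ‖∏ j ∈ Finset.range m, ((2 * ((j + k : ℕ) : ℂ) + 1) - 2 * (n : ℂ))‖ := by
  rw [norm_prod]
  exact Finset.one_le_prod fun j _ => one_le_norm_odd_sub_even _ _

theorem norm_sphBesselYCoeff (n m : ℕ) : ‖sphBesselYCoeff n m‖ =
    1 / ((2 : ℝ) ^ m * (m.factorial : ℝ) *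
      ‖∏ j ∈ Finset.range m, ((2 * (j : ℂ) + 1) - 2 * (n : ℂ))‖) := by
  simp only [sphBesselYCoeff, norm_div, norm_mul, norm_pow, norm_neg, norm_one, one_pow,
    Complex.norm_natCast, Complex.norm_ofNat]

theorem norm_sphBesselYCoeff_le (n m : ℕ) : ‖sphBesselYCoeff n m‖ ≤ 1 / (m.factorial : ℝ) := by
  rw [norm_sphBesselYCoeff]
  have h1 : (1 : ℝ) ≤ 2 ^ m := one_le_pow₀ (by norm_num)
  have h2 := one_le_norm_prod_odd_sub_even n m 0
  simp only [add_zero] at h2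
  gcongr
  calc (m.factorial : ℝ) = 1 * m.factorial * 1 := by ring
    _ ≤ _ := by gcongr

theorem sub_mul_norm_sphBesselYCoeff_le (n m : ℕ) (hn : 1 ≤ n) :
    ‖-((n : ℂ) + 1) + 2 * (m + 1 : ℕ)‖ * ‖sphBesselYCoeff n (m + 1)‖
      ≤ (2 * ((m + 1 : ℕ) : ℝ) + 2) * (1 / ((m + 1).factorial : ℝ)) := by
  have hn' : (1 : ℝ) ≤ n := by exact_mod_cast hn
  have hm : (0 : ℝ) ≤ m := by positivity
  have h1 : (1 : ℝ) ≤ 2 ^ (m + 1) := one_le_pow₀ (by norm_num)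
  have h2 : 2 * (n : ℝ) - 1
      ≤ ‖∏ j ∈ Finset.range (m + 1), ((2 * (j : ℂ) + 1) - 2 * (n : ℂ))‖ := by
    rw [Finset.prod_range_succ', norm_mul]
    have h3 : ‖(2 * ((0 : ℕ) : ℂ) + 1) - 2 * (n : ℂ)‖ = 2 * n - 1 := by
      rw [show (2 * ((0 : ℕ) : ℂ) + 1) - 2 * (n : ℂ) = ((1 - 2 * n : ℝ) : ℂ) by push_cast; ring,
        Complex.norm_real, Real.norm_eq_abs, abs_of_nonpos (by linarith)]
      ring
    rw [h3]
    exact le_mul_of_one_le_left (by linarith) (one_le_norm_prod_odd_sub_even n m 1)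
  have h4 : ‖-((n : ℂ) + 1) + 2 * (m + 1 : ℕ)‖ ≤ (2 * ((m + 1 : ℕ) : ℝ) + 2) * (2 * n - 1) := by
    refine (norm_add_le _ _).trans ?_
    rw [norm_neg, show (n : ℂ) + 1 = ((n + 1 : ℕ) : ℂ) by push_cast; ring,
      show (2 : ℂ) * (m + 1 : ℕ) = ((2 * (m + 1) : ℕ) : ℂ) by push_cast; ring,
      Complex.norm_natCast, Complex.norm_natCast]
    push_cast
    nlinarith
  rw [norm_sphBesselYCoeff, mul_one_div, mul_one_div]
  have h5 : (0 : ℝ) < 2 * n - 1 := by linarith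
  have h6 := h5.trans_le h2
  rw [div_le_div_iff₀ (by positivity) (by positivity)]
  calc _ ≤ (2 * ((m + 1 : ℕ) : ℝ) + 2) * (2 * n - 1) * ((m + 1).factorial : ℝ) := by gcongr
    _ = (2 * ((m + 1 : ℕ) : ℝ) + 2) * (1 * ((m + 1).factorial : ℝ) * (2 * n - 1)) := by ring
    _ ≤ _ := by gcongr

theorem sphBesselJ_eq_zpow_mul_tsum (n : ℕ) (z : ℂ) :
    sphBesselJ n z = z ^ (n : ℤ) * ∑' m : ℕ, sphBesselJCoeff n m * z ^ (2 * m) := by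
  rw [sphBesselJ, ← tsum_mul_left]
  refine tsum_congr fun m => ?_
  rw [sphBesselJCoeff, zpow_natCast, pow_add]
  ring

theorem factorial_div_eq_doubleFactorial (n : ℕ) :
    (Nat.factorial (2 * n) : ℂ) / ((2 : ℂ) ^ n * (Nat.factorial n : ℂ))
      = (Nat.doubleFactorial (2 * n - 1) : ℂ) := by
  rcases n with _ | n
  · simp
  · have h := Nat.factorial_eq_mul_doubleFactorial (2 * n + 1)
    rw [show 2 * n + 1 + 1 = 2 * (n + 1) by ring, Nat.doubleFactorial_two_mul] at h
    rw [h, show 2 * (n + 1) - 1 = 2 * n + 1 by omega, div_eq_iff]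
    · push_cast; ring
    · exact mul_ne_zero (pow_ne_zero _ two_ne_zero)
        (Nat.cast_ne_zero.2 (Nat.factorial_ne_zero _))

theorem sphBesselY_eq_zpow_mul_tsum (n : ℕ) (z : ℂ) (hz : z ≠ 0) :
    sphBesselY n z = -(Nat.doubleFactorial (2 * n - 1) : ℂ) *
      (z ^ (-((n : ℤ) + 1)) * ∑' m : ℕ, sphBesselYCoeff n m * z ^ (2 * m)) := by
  rw [sphBesselY, factorial_div_eq_doubleFactorial, ← tsum_mul_left (a := z ^ (-((n : ℤ) + 1)))]
  congr 1
  refine tsum_congr fun m => ?_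
  rw [sphBesselYCoeff, show 2 * (m : ℤ) - n - 1 = -((n : ℤ) + 1) + ((2 * m : ℕ) : ℤ) by
    push_cast; ring, zpow_add₀ hz, zpow_natCast]
  ring

theorem hasDerivAt_sphHankelH1 (n : ℕ) (x : ℂ) (hx : x ≠ 0) :
    HasDerivAt (sphHankelH1 n)
      (x ^ ((n : ℤ) - 1) *
          ∑' m : ℕ, ((n : ℂ) + 2 * m) * (sphBesselJCoeff n m * x ^ (2 * m)) +
        I * (-(Nat.doubleFactorial (2 * n - 1) : ℂ) * (x ^ (-((n : ℤ) + 1) - 1) *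
          ∑' m : ℕ, (-((n : ℂ) + 1) + 2 * m) * (sphBesselYCoeff n m * x ^ (2 * m))))) x := by
  have hJ := hasDerivAt_zpow_mul_tsum_even_pow _ (norm_sphBesselJCoeff_le n) n x hx
  have hY := hasDerivAt_zpow_mul_tsum_even_pow _ (norm_sphBesselYCoeff_le n) (-((n : ℤ) + 1)) x hx
  push_cast at hJ hY
  refine (hJ.add ((hY.const_mul (-(Nat.doubleFactorial (2 * n - 1) : ℂ))).const_mul
    I)).congr_of_eventuallyEq ?_
  filter_upwards [isOpen_ne.mem_nhds hx] with z hz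
  simp only [sphHankelH1, sphBesselJ_eq_zpow_mul_tsum, sphBesselY_eq_zpow_mul_tsum n z hz,
    Pi.add_apply]

theorem norm_tsum_sphBesselJCoeff_le (n : ℕ) (x : ℂ) :
    ‖∑' m : ℕ, ((n : ℂ) + 2 * m) * (sphBesselJCoeff n m * x ^ (2 * m))‖
      ≤ 1 / (n.factorial : ℝ) * ∑' m : ℕ, (‖x‖ ^ 2) ^ m / (m.factorial : ℝ) := by
  rw [← tsum_mul_left]
  refine tsum_of_norm_bounded
    ((Real.summable_pow_div_factorial (‖x‖ ^ 2)).mul_left _).hasSum fun m => ?_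
  rw [← mul_assoc, norm_mul, norm_mul, norm_pow]
  calc _ ≤ 1 / (n.factorial : ℝ) * (1 / (m.factorial : ℝ)) * ‖x‖ ^ (2 * m) := by
        refine mul_le_mul_of_nonneg_right ?_ (by positivity)
        exact add_mul_norm_sphBesselJCoeff_le n m
    _ = _ := by rw [← pow_mul]; ring

theorem norm_tsum_sphBesselYCoeff_add_le (n : ℕ) (hn : 1 ≤ n) (x : ℂ) :
    ‖∑' m : ℕ, (-((n : ℂ) + 1) + 2 * m) * (sphBesselYCoeff n m * x ^ (2 * m)) + ((n : ℂ) + 1)‖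
      ≤ ∑' m : ℕ, (2 * ((m + 1 : ℕ) : ℝ) + 2) *
          ((‖x‖ ^ 2) ^ (m + 1) / ((m + 1).factorial : ℝ)) := by
  rw [(summable_shifted_even_pow _ (norm_sphBesselYCoeff_le n) _ x).tsum_eq_zero_add]
  have h0 : (-((n : ℂ) + 1) + 2 * (0 : ℕ)) * (sphBesselYCoeff n 0 * x ^ (2 * 0))
      = -((n : ℂ) + 1) := by
    simp [sphBesselYCoeff]
  rw [h0, neg_add_eq_sub, sub_add_cancel]
  refine tsum_of_norm_bounded ((summable_nat_add_iff 1).2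
    (summable_two_mul_add_two_mul_pow_div_factorial (‖x‖ ^ 2) (by positivity))).hasSum fun m => ?_
  rw [← mul_assoc, norm_mul, norm_mul, norm_pow]
  calc _ ≤ (2 * ((m + 1 : ℕ) : ℝ) + 2) * (1 / ((m + 1).factorial : ℝ)) * ‖x‖ ^ (2 * (m + 1)) := by
        refine mul_le_mul_of_nonneg_right ?_ (by positivity)
        exact sub_mul_norm_sphBesselYCoeff_le n m hn
    _ = _ := by rw [← pow_mul]; ring

/-- large-order asymptotics of the derivative of the spherical Hankel function. -/
theorem sphHankelH1_deriv_large_order (x : ℂ) (hx : x ≠ 0) :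
    ∃ C > (0 : ℝ), ∀ n : ℕ, 1 ≤ n →
      ‖Complex.I * x ^ (n + 2) * deriv (sphHankelH1 n) x
          + ((n : ℂ) + 1) * (Nat.doubleFactorial (2 * n - 1) : ℂ)‖
        ≤ C * (Nat.doubleFactorial (2 * n - 1) : ℝ) := by
  set E : ℝ := ∑' m : ℕ, (‖x‖ ^ 2) ^ m / (m.factorial : ℝ)
  set T : ℝ := ∑' m : ℕ, (2 * ((m + 1 : ℕ) : ℝ) + 2) *
    ((‖x‖ ^ 2) ^ (m + 1) / ((m + 1).factorial : ℝ))
  have hE0 : 0 ≤ E := tsum_nonneg fun m => by positivity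
  have hT0 : 0 ≤ T := tsum_nonneg fun m => by positivity
  refine ⟨‖x‖ * E * E + T + 1, by positivity, fun n hn => ?_⟩
  rw [(hasDerivAt_sphHankelH1 n x hx).deriv]
  have hJ := norm_tsum_sphBesselJCoeff_le n x
  have hY := norm_tsum_sphBesselYCoeff_add_le n hn x
  set SJ := ∑' m : ℕ, ((n : ℂ) + 2 * m) * (sphBesselJCoeff n m * x ^ (2 * m))
  set SY := ∑' m : ℕ, (-((n : ℂ) + 1) + 2 * m) * (sphBesselYCoeff n m * x ^ (2 * m))
  have hD : (1 : ℝ) ≤ (Nat.doubleFactorial (2 * n - 1) : ℝ) := by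
    exact_mod_cast Nat.doubleFactorial_pos _
  have e1 : x ^ (n + 2) * x ^ ((n : ℤ) - 1) = x ^ (2 * n + 1) := by
    rw [← zpow_natCast, ← zpow_natCast, ← zpow_add₀ hx]
    congr 1
    push_cast
    ring
  have e2 : x ^ (n + 2) * x ^ (-((n : ℤ) + 1) - 1) = 1 := by
    rw [← zpow_natCast, ← zpow_add₀ hx, show ((n + 2 : ℕ) : ℤ) + (-((n : ℤ) + 1) - 1) = 0 by
      push_cast; ring, zpow_zero]
  set D : ℂ := (Nat.doubleFactorial (2 * n - 1) : ℂ)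
  have key : I * x ^ (n + 2) * (x ^ ((n : ℤ) - 1) * SJ + I * (-D * (x ^ (-((n : ℤ) + 1) - 1) * SY)))
      + ((n : ℂ) + 1) * D = I * x ^ (2 * n + 1) * SJ + D * (SY + ((n : ℂ) + 1)) := by
    linear_combination (I * SJ) * e1 - (I ^ 2 * D * SY) * e2 - D * SY * I_sq
  rw [key]
  have hDn : ‖D‖ = (Nat.doubleFactorial (2 * n - 1) : ℝ) := Complex.norm_natCast _
  have hterm : (‖x‖ ^ 2) ^ n / (n.factorial : ℝ) ≤ E :=
    (Real.summable_pow_div_factorial (‖x‖ ^ 2)).le_tsum n fun m _ => by positivity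
  have b1 : ‖I * x ^ (2 * n + 1) * SJ‖ ≤ ‖x‖ * E * E := by
    rw [norm_mul, norm_mul, norm_I, one_mul, norm_pow]
    calc ‖x‖ ^ (2 * n + 1) * ‖SJ‖ ≤ ‖x‖ ^ (2 * n + 1) * (1 / (n.factorial : ℝ) * E) := by gcongr
      _ = ‖x‖ * ((‖x‖ ^ 2) ^ n / (n.factorial : ℝ)) * E := by rw [← pow_mul]; ring
      _ ≤ _ := by gcongr
  have b2 : ‖D * (SY + ((n : ℂ) + 1))‖ ≤ T * (Nat.doubleFactorial (2 * n - 1) : ℝ) := by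
    rw [norm_mul, hDn, mul_comm]
    gcongr
  have b3 : 0 ≤ ‖x‖ * E * E := by positivity
  calc _ ≤ ‖x‖ * E * E + T * (Nat.doubleFactorial (2 * n - 1) : ℝ) :=
        (norm_add_le _ _).trans (add_le_add b1 b2)
    _ ≤ _ := by nlinarith
end

section
/- (Reality of the zeros of j_n.) For every integer n ≥ 0, every zero of the spherical Bessel function j_n is real: if x ∈ ℂ satisfies j_n(x) = 0, then x ∈ ℝ. In particular, j_n(x) ≠ 0 whenever Im(x) ≠ 0. -/
open Complex

open Filter Topology

theorem pow_mul_doubleFactorial_le (n m : ℕ) :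
    (n + 1) ^ m * Nat.doubleFactorial (2 * n + 1) ≤ Nat.doubleFactorial (2 * (n + m) + 1) := by
  induction m with
  | zero => simp
  | succ m ih =>
    have h : Nat.doubleFactorial (2 * (n + (m + 1)) + 1) =
        (2 * (n + m) + 3) * Nat.doubleFactorial (2 * (n + m) + 1) := by
      rw [← Nat.doubleFactorial_add_two]
      ring_nf
    rw [h, pow_succ', mul_assoc]
    exact Nat.mul_le_mul (by omega) ih

theorem factorial_le_doubleFactorial_odd (n : ℕ) :
    Nat.factorial n ≤ Nat.doubleFactorial (2 * n + 1) := by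
  induction n with
  | zero => simp
  | succ n ih =>
    have h : Nat.doubleFactorial (2 * (n + 1) + 1) =
        (2 * n + 3) * Nat.doubleFactorial (2 * n + 1) := by
      rw [← Nat.doubleFactorial_add_two]
      ring_nf
    rw [h, Nat.factorial_succ]
    exact Nat.mul_le_mul (by omega) ih

/-- The power series of `j_n` divided by its leading term `x ^ n / (2n+1)!!`. -/
noncomputable def sphBesselJNormalizedTerm (x : ℂ) (n m : ℕ) : ℂ :=
  (-1 : ℂ) ^ m * x ^ (2 * m) * (Nat.doubleFactorial (2 * n + 1) : ℂ) /
    ((2 : ℂ) ^ m * (Nat.factorial m : ℂ) * (Nat.doubleFactorial (2 * (n + m) + 1) : ℂ))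

theorem norm_sphBesselJNormalizedTerm_le (x : ℂ) (n m : ℕ) :
    ‖sphBesselJNormalizedTerm x n m‖ ≤
      (‖x‖ ^ 2) ^ m / (Nat.factorial m : ℝ) * (1 / ((n : ℝ) + 1)) ^ m := by
  have h : ((n : ℝ) + 1) ^ m * (Nat.doubleFactorial (2 * n + 1) : ℝ) ≤
      (Nat.doubleFactorial (2 * (n + m) + 1) : ℝ) := by
    exact_mod_cast pow_mul_doubleFactorial_le n m
  have hd : (0 : ℝ) < Nat.doubleFactorial (2 * (n + m) + 1) := by
    exact_mod_cast Nat.doubleFactorial_pos _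
  have hf : (0 : ℝ) < Nat.factorial m := by exact_mod_cast Nat.factorial_pos m
  have h2 : (1 : ℝ) ≤ 2 ^ m := one_le_pow₀ (by norm_num)
  simp only [sphBesselJNormalizedTerm, norm_div, norm_mul, norm_pow, norm_neg, norm_one, one_pow,
    one_mul, Complex.norm_natCast, Complex.norm_ofNat]
  rw [one_div, inv_pow, ← div_eq_mul_inv, div_div, div_le_div_iff₀ (by positivity) (by positivity),
    ← pow_mul, mul_assoc]
  refine mul_le_mul_of_nonneg_left ?_ (by positivity)
  calc (Nat.doubleFactorial (2 * n + 1) : ℝ) * (Nat.factorial m * ((n : ℝ) + 1) ^ m)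
      = Nat.factorial m * (((n : ℝ) + 1) ^ m * Nat.doubleFactorial (2 * n + 1)) := by ring
    _ ≤ Nat.factorial m * Nat.doubleFactorial (2 * (n + m) + 1) := by gcongr
    _ ≤ 2 ^ m * (Nat.factorial m * Nat.doubleFactorial (2 * (n + m) + 1)) :=
        le_mul_of_one_le_left (by positivity) h2
    _ = _ := by ring

theorem norm_sphBesselJNormalizedTerm_le_pow_div_factorial (x : ℂ) (n m : ℕ) :
    ‖sphBesselJNormalizedTerm x n m‖ ≤ (‖x‖ ^ 2) ^ m / (Nat.factorial m : ℝ) := by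
  refine (norm_sphBesselJNormalizedTerm_le x n m).trans ?_
  refine mul_le_of_le_one_right (by positivity) (pow_le_one₀ (by positivity) ?_)
  rw [div_le_one (by positivity)]
  linarith [(Nat.cast_nonneg n : (0 : ℝ) ≤ n)]

theorem summable_sphBesselJNormalizedTerm (x : ℂ) (n : ℕ) :
    Summable (sphBesselJNormalizedTerm x n) :=
  .of_norm_bounded (Real.summable_pow_div_factorial _)
    (norm_sphBesselJNormalizedTerm_le_pow_div_factorial x n)

theorem sphBesselJ_term_eq (n : ℕ) (x : ℂ) (m : ℕ) :
    ((-1 : ℂ) ^ m * x ^ (n + 2 * m)) /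
      ((2 : ℂ) ^ m * (Nat.factorial m : ℂ) * (Nat.doubleFactorial (2 * (n + m) + 1) : ℂ)) =
    x ^ n / (Nat.doubleFactorial (2 * n + 1) : ℂ) * sphBesselJNormalizedTerm x n m := by
  have h : (Nat.doubleFactorial (2 * n + 1) : ℂ) ≠ 0 := by
    exact_mod_cast (Nat.doubleFactorial_pos _).ne'
  rw [sphBesselJNormalizedTerm, pow_add]
  field_simp

theorem sphBesselJ_eq_mul_tsum (n : ℕ) (x : ℂ) :
    sphBesselJ n x = x ^ n / (Nat.doubleFactorial (2 * n + 1) : ℂ) *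
      ∑' m, sphBesselJNormalizedTerm x n m := by
  rw [sphBesselJ, ← tsum_mul_left]
  exact tsum_congr (sphBesselJ_term_eq n x)

theorem hasSum_sphBesselJ (n : ℕ) (x : ℂ) :
    HasSum (fun m : ℕ ↦ ((-1 : ℂ) ^ m * x ^ (n + 2 * m)) /
      ((2 : ℂ) ^ m * (Nat.factorial m : ℂ) * (Nat.doubleFactorial (2 * (n + m) + 1) : ℂ)))
      (sphBesselJ n x) := by
  refine Summable.hasSum ?_
  simp only [sphBesselJ_term_eq]
  exact (summable_sphBesselJNormalizedTerm x n).mul_left _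

theorem tendsto_tsum_sphBesselJNormalizedTerm (x : ℂ) :
    Tendsto (fun n ↦ ∑' m, sphBesselJNormalizedTerm x n m) atTop (𝓝 1) := by
  have key : Tendsto (fun n ↦ ∑' m, sphBesselJNormalizedTerm x n m) atTop
      (𝓝 (∑' m : ℕ, if m = 0 then (1 : ℂ) else 0)) := by
    refine tendsto_tsum_of_dominated_convergence
      (bound := fun m : ℕ ↦ (‖x‖ ^ 2) ^ m / (Nat.factorial m : ℝ))
      (Real.summable_pow_div_factorial _) (fun m ↦ ?_)
      (.of_forall fun n m ↦ norm_sphBesselJNormalizedTerm_le_pow_div_factorial x n m)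
    rcases eq_or_ne m 0 with rfl | hm
    · have h (n : ℕ) : sphBesselJNormalizedTerm x n 0 = 1 := by
        have : (Nat.doubleFactorial (2 * n + 1) : ℂ) ≠ 0 := by
          exact_mod_cast (Nat.doubleFactorial_pos _).ne'
        simp [sphBesselJNormalizedTerm, this]
      simp [h]
    · rw [if_neg hm]
      refine squeeze_zero_norm (fun n ↦ norm_sphBesselJNormalizedTerm_le x n m) ?_
      have h := ((tendsto_one_div_add_atTop_nhds_zero_nat (𝕜 := ℝ)).pow m).const_mul
        ((‖x‖ ^ 2) ^ m / (Nat.factorial m : ℝ))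
      simpa [hm] using h
  simpa using key

theorem tendsto_sphBesselJ_atTop (x : ℂ) :
    Tendsto (fun n ↦ sphBesselJ n x) atTop (𝓝 0) := by
  have h : Tendsto (fun n : ℕ ↦ x ^ n / (Nat.doubleFactorial (2 * n + 1) : ℂ)) atTop (𝓝 0) := by
    refine squeeze_zero_norm (fun n ↦ ?_)
      (FloorSemiring.tendsto_pow_div_factorial_atTop ‖x‖)
    rw [norm_div, norm_pow, Complex.norm_natCast]
    have h1 : (0 : ℝ) < Nat.factorial n := by exact_mod_cast Nat.factorial_pos n
    have h2 : (Nat.factorial n : ℝ) ≤ Nat.doubleFactorial (2 * n + 1) := by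
      exact_mod_cast factorial_le_doubleFactorial_odd n
    gcongr
  simpa [sphBesselJ_eq_mul_tsum] using h.mul (tendsto_tsum_sphBesselJNormalizedTerm x)

theorem eventually_sphBesselJ_ne_zero {x : ℂ} (hx : x ≠ 0) :
    ∀ᶠ n in atTop, sphBesselJ n x ≠ 0 := by
  filter_upwards [(tendsto_tsum_sphBesselJNormalizedTerm x).eventually_ne one_ne_zero] with n hn
  rw [sphBesselJ_eq_mul_tsum]
  have : (Nat.doubleFactorial (2 * n + 1) : ℂ) ≠ 0 := by
    exact_mod_cast (Nat.doubleFactorial_pos _).ne'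
  exact mul_ne_zero (div_ne_zero (pow_ne_zero n hx) this) hn

theorem sphBesselJ_recurrence (n : ℕ) (x : ℂ) :
    x * (sphBesselJ n x + sphBesselJ (n + 2) x) = (2 * n + 3) * sphBesselJ (n + 1) x := by
  have h0 := (hasSum_nat_add_iff' 1).mpr ((hasSum_sphBesselJ n x).mul_left x)
  have h1 := (hasSum_nat_add_iff' 1).mpr
    ((hasSum_sphBesselJ (n + 1) x).mul_left (2 * (n : ℂ) + 3))
  have h2 := (hasSum_sphBesselJ (n + 2) x).mul_left x
  have h3 : Nat.doubleFactorial (2 * (n + 1) + 1) =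
      (2 * n + 3) * Nat.doubleFactorial (2 * n + 1) := Nat.doubleFactorial_add_two _
  have hn : (Nat.doubleFactorial (2 * n + 1) : ℂ) ≠ 0 := by
    exact_mod_cast (Nat.doubleFactorial_pos _).ne'
  have hn3 : (2 * (n : ℂ) + 3) ≠ 0 := by exact_mod_cast (by omega : 2 * n + 3 ≠ 0)
  have h := (h0.add h2).tsum_eq.symm.trans ((tsum_congr fun m ↦ ?_).trans h1.tsum_eq)
  · simp only [Finset.sum_range_one, mul_zero, pow_zero, add_zero, Nat.factorial_zero,
      Nat.cast_one, one_mul, h3, Nat.cast_mul, Nat.cast_add, Nat.cast_ofNat] at h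
    field_simp at h
    refine mul_left_cancel₀ hn ?_
    linear_combination h
  · have e0 : 2 * (n + (m + 1)) + 1 = 2 * (n + m) + 1 + 2 := by ring
    have e1 : 2 * (n + 1 + (m + 1)) + 1 = 2 * (n + m) + 1 + 2 + 2 := by ring
    have e2 : 2 * (n + 2 + m) + 1 = 2 * (n + m) + 1 + 2 + 2 := by ring
    have hd : (Nat.doubleFactorial (2 * (n + m) + 1) : ℂ) ≠ 0 := by
      exact_mod_cast (Nat.doubleFactorial_pos _).ne'
    have hf : (Nat.factorial m : ℂ) ≠ 0 := by exact_mod_cast Nat.factorial_ne_zero m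
    have hm : (m : ℂ) + 1 ≠ 0 := by exact_mod_cast Nat.succ_ne_zero m
    have ha : 2 * ((n : ℂ) + m) + 3 ≠ 0 := by
      exact_mod_cast (by omega : 2 * (n + m) + 3 ≠ 0)
    have hb : 2 * ((n : ℂ) + m) + 3 + 2 ≠ 0 := by
      exact_mod_cast (by omega : 2 * (n + m) + 3 + 2 ≠ 0)
    rw [e0, e1, e2]
    simp only [Nat.doubleFactorial_add_two, Nat.factorial_succ]
    push_cast
    field_simp
    ring

theorem im_mul_conj_sphBesselJ_sub (n : ℕ) {x : ℂ} (hx : x ≠ 0) :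
    (sphBesselJ n x * (starRingEnd ℂ) (sphBesselJ (n + 1) x)).im -
      (sphBesselJ (n + 1) x * (starRingEnd ℂ) (sphBesselJ (n + 2) x)).im =
    (2 * n + 3) * x⁻¹.im * normSq (sphBesselJ (n + 1) x) := by
  have h : sphBesselJ n x =
      ((2 * n + 3 : ℝ) : ℂ) * (x⁻¹ * sphBesselJ (n + 1) x) - sphBesselJ (n + 2) x := by
    have := sphBesselJ_recurrence n x
    push_cast
    field_simp
    linear_combination this
  rw [h]
  simp only [mul_im, sub_re, sub_im, ofReal_re, ofReal_im, mul_re, conj_re, conj_im,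
    normSq_apply]
  ring

theorem sphBesselJ_ne_zero_of_im_ne_zero (n : ℕ) {x : ℂ} (hx : x.im ≠ 0) :
    sphBesselJ n x ≠ 0 := by
  intro hn
  have hx0 : x ≠ 0 := by rintro rfl; simp at hx
  have hc : x⁻¹.im ≠ 0 := by
    rw [inv_im]
    exact div_ne_zero (neg_ne_zero.mpr hx) (normSq_pos.mpr hx0).ne'
  set w : ℕ → ℝ := fun k ↦
    x⁻¹.im * (sphBesselJ k x * (starRingEnd ℂ) (sphBesselJ (k + 1) x)).im with hw
  have hstep (k : ℕ) : w k - w (k + 1) =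
      (2 * k + 3) * x⁻¹.im ^ 2 * normSq (sphBesselJ (k + 1) x) := by
    simp only [hw]
    linear_combination x⁻¹.im * im_mul_conj_sphBesselJ_sub k hx0
  have hanti : Antitone w := antitone_nat_of_succ_le fun k ↦ by
    have : 0 ≤ (2 * k + 3) * x⁻¹.im ^ 2 * normSq (sphBesselJ (k + 1) x) :=
      mul_nonneg (by positivity) (normSq_nonneg _)
    linarith [hstep k]
  have hlim : Tendsto w atTop (𝓝 0) := by
    have h0 := tendsto_sphBesselJ_atTop x
    have h1 := (continuous_conj.tendsto _).comp (h0.comp (tendsto_add_atTop_nat 1))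
    have h2 := ((continuous_im.tendsto _).comp (h0.mul h1)).const_mul x⁻¹.im
    simpa [hw, Function.comp_def] using h2
  have hwn : w n = 0 := by simp [hw, hn]
  have hw0 (k : ℕ) (hk : n ≤ k) : w k = 0 :=
    le_antisymm (hwn ▸ hanti hk) (hanti.le_of_tendsto hlim k)
  obtain ⟨k, hk, hkn⟩ := ((((tendsto_add_atTop_nat 1).eventually
    (eventually_sphBesselJ_ne_zero hx0))).and (eventually_ge_atTop n)).exists
  have h := hstep k
  rw [hw0 k hkn, hw0 (k + 1) (by omega), sub_zero] at h
  have hpos : 0 < (2 * (k : ℝ) + 3) * x⁻¹.im ^ 2 * normSq (sphBesselJ (k + 1) x) :=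
    mul_pos (by positivity) (normSq_pos.mpr hk)
  exact hpos.ne h

/-- every zero of `j_n` is real; in particular `j_n(x) ≠ 0` if `Im x ≠ 0`. -/
theorem sphBesselJ_zeros_real (n : ℕ) :
    (∀ x : ℂ, sphBesselJ n x = 0 → x.im = 0) ∧
    (∀ x : ℂ, x.im ≠ 0 → sphBesselJ n x ≠ 0) := by
  have h (x : ℂ) (hx : x.im ≠ 0) := sphBesselJ_ne_zero_of_im_ne_zero n hx
  exact ⟨fun x hx ↦ by_contra fun him ↦ h x him hx, h⟩
end
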